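/- Let n ≥ 1 and let λ, λ' : {0,1,…,n} → ℝ be strictly dominant (λ(0) > λ(1) > … > λ(n), and likewise for λ'), integral (λ(i) − λ(j) ∈ ℤ for all i,j, and likewise for λ'), and normalized (∑_k λ(k) = ∑_k λ'(k) = 0). If λ ≠ λ', then ∫_{[0,1]^n} 𝒮_λ(t) · conj(𝒮_{λ'}(t)) dt = 0. -/

import Mathlib

theorem integral_Icc_exp_two_pi_int {m : ℤ} (hm : m ≠ 0) :
    ∫ x in Set.Icc (0 : ℝ) 1, Complex.exp (2 * Real.pi * Complex.I * (m * x)) = 0 := by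
  have hc : 2 * Real.pi * Complex.I * m ≠ 0 :=
    mul_ne_zero Complex.two_pi_I_ne_zero (Int.cast_ne_zero.mpr hm)
  rw [MeasureTheory.integral_Icc_eq_integral_Ioc, ← intervalIntegral.integral_of_le zero_le_one]
  simp_rw [← mul_assoc]
  rw [integral_exp_mul_complex hc]
  have h : Complex.exp (2 * Real.pi * Complex.I * m) = 1 := by
    rw [mul_comm]
    exact Complex.exp_int_mul_two_pi_mul_I m
  simp [h]

theorem integral_unit_cube_exp_two_pi_int {n : ℕ} {m : Fin n → ℤ} (hm : m ≠ 0) :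
    ∫ t in Set.univ.pi fun _ : Fin n => Set.Icc (0 : ℝ) 1,
      Complex.exp (2 * Real.pi * Complex.I * ((∑ j, m j * t j : ℝ) : ℂ)) = 0 := by
  obtain ⟨j, hj⟩ := Function.ne_iff.mp hm
  rw [MeasureTheory.volume_pi, MeasureTheory.Measure.restrict_pi_pi]
  push_cast
  simp_rw [Finset.mul_sum, Complex.exp_sum]
  rw [MeasureTheory.integral_fintype_prod_eq_prod
    (f := fun j (x : ℝ) => Complex.exp (2 * Real.pi * Complex.I * (m j * x)))]
  exact Finset.prod_eq_zero (Finset.mem_univ j) (integral_Icc_exp_two_pi_int hj)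

theorem eq_of_sub_succ_eq_of_sum_eq {n : ℕ} {a b : Fin (n + 1) → ℝ}
    (hdiff : ∀ j : Fin n, a j.castSucc - a j.succ = b j.castSucc - b j.succ)
    (hsum : ∑ k, a k = ∑ k, b k) : a = b := by
  have hconst : ∀ k, a k - b k = a 0 - b 0 := by
    intro k
    induction k using Fin.induction with
    | zero => rfl
    | succ j ih => linarith [hdiff j]
  have h : ∑ k, (a k - b k) = 0 := by rw [Finset.sum_sub_distrib, hsum, sub_self]
  simp only [hconst, Finset.sum_const, Finset.card_univ, Fintype.card_fin, nsmul_eq_mul] at h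
  have h0 : a 0 - b 0 = 0 := (mul_eq_zero.mp h).resolve_left (by positivity)
  ext k
  linarith [hconst k]

theorem StrictAnti.eq_of_comp_perm_eq {n : ℕ} {a b : Fin n → ℝ} (ha : StrictAnti a)
    (hb : StrictAnti b) {s s' : Equiv.Perm (Fin n)} (h : a ∘ s = b ∘ s') : a = b := by
  have hr : Set.range a = Set.range b := by
    rw [← s.surjective.range_comp a, h, s'.surjective.range_comp b]
  have hn : (fun i => -a i) = fun i => -b i := by
    refine (StrictMono.range_inj ha.neg hb.neg).mp ?_
    rw [← Function.comp_def Neg.neg a, ← Function.comp_def Neg.neg b, Set.range_comp,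
      Set.range_comp, hr]
  ext i
  exact neg_injective (congrFun hn i)

theorem exp_two_pi_mul_conj_exp_two_pi {n : ℕ} (u v t : Fin n → ℝ) :
    Complex.exp (2 * Real.pi * Complex.I * ((∑ j, u j * t j : ℝ) : ℂ)) *
      (starRingEnd ℂ) (Complex.exp (2 * Real.pi * Complex.I * ((∑ j, v j * t j : ℝ) : ℂ))) =
    Complex.exp (2 * Real.pi * Complex.I * ((∑ j, (u j - v j) * t j : ℝ) : ℂ)) := by
  rw [← Complex.exp_conj, ← Complex.exp_add]
  simp only [map_mul, Complex.conj_I, Complex.conj_ofReal, map_ofNat, sub_mul _ _ (t _),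
    Finset.sum_sub_distrib, Complex.ofReal_sub]
  congr 1
  ring

open MeasureTheory in
theorem integral_unit_cube_trigonometric_sum_mul_conj_eq_zero {ι κ : Type*} [Fintype ι]
    [Fintype κ] {n : ℕ} (c : ι → ℂ) (d : κ → ℂ) (u : ι → Fin n → ℝ) (v : κ → Fin n → ℝ)
    (h : ∀ i k, ∃ m : Fin n → ℤ, m ≠ 0 ∧ ∀ j, u i j - v k j = m j) :
    ∫ t in Set.univ.pi fun _ : Fin n => Set.Icc (0 : ℝ) 1,
      (∑ i, c i * Complex.exp (2 * Real.pi * Complex.I * ((∑ j, u i j * t j : ℝ) : ℂ))) *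
        (starRingEnd ℂ)
          (∑ k, d k * Complex.exp (2 * Real.pi * Complex.I * ((∑ j, v k j * t j : ℝ) : ℂ))) =
      0 := by
  have hcompact : IsCompact (Set.univ.pi fun _ : Fin n => Set.Icc (0 : ℝ) 1) :=
    isCompact_univ_pi fun _ => isCompact_Icc
  simp_rw [map_sum, map_mul, Finset.sum_mul_sum, mul_mul_mul_comm,
    exp_two_pi_mul_conj_exp_two_pi]
  rw [integral_finsetSum _ fun i _ =>
    (Continuous.continuousOn (by fun_prop)).integrableOn_compact hcompact]
  refine Finset.sum_eq_zero fun i _ => ?_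
  rw [integral_finsetSum _ fun k _ =>
    (Continuous.continuousOn (by fun_prop)).integrableOn_compact hcompact]
  refine Finset.sum_eq_zero fun k _ => ?_
  obtain ⟨m, hm, hmeq⟩ := h i k
  simp_rw [hmeq]
  rw [integral_const_mul, integral_unit_cube_exp_two_pi_int hm, mul_zero]

open MeasureTheory in
/-- Continuous orthogonality of `S`-orbit functions of `A_n` labeled by two
distinct strictly dominant, integral, normalized weights, over a unit cell in
the simple-root basis. -/
theorem stmt_9 (n : ℕ) (hn : 1 ≤ n) (lam lam' : Fin (n + 1) → ℝ)
    (hdom : ∀ i : Fin n, lam i.succ < lam i.castSucc)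
    (hdom' : ∀ i : Fin n, lam' i.succ < lam' i.castSucc)
    (hint : ∀ i j : Fin (n + 1), ∃ m : ℤ, lam i - lam j = m)
    (hint' : ∀ i j : Fin (n + 1), ∃ m : ℤ, lam' i - lam' j = m)
    (hsum : ∑ k : Fin (n + 1), lam k = 0)
    (hsum' : ∑ k : Fin (n + 1), lam' k = 0)
    (hne : lam ≠ lam') :
    ∫ t in Set.univ.pi fun _ : Fin n => Set.Icc (0 : ℝ) 1,
      (∑ s : Equiv.Perm (Fin (n + 1)),
          ((Equiv.Perm.sign s : ℤ) : ℂ) *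
            Complex.exp (2 * Real.pi * Complex.I *
              ((∑ j : Fin n, (lam (s j.castSucc) - lam (s j.succ)) * t j : ℝ) : ℂ))) *
        (starRingEnd ℂ)
          (∑ s : Equiv.Perm (Fin (n + 1)),
            ((Equiv.Perm.sign s : ℤ) : ℂ) *
              Complex.exp (2 * Real.pi * Complex.I *
                ((∑ j : Fin n, (lam' (s j.castSucc) - lam' (s j.succ)) * t j : ℝ) : ℂ))) = 0 := by
  choose p hp using hint
  choose q hq using hint'
  refine integral_unit_cube_trigonometric_sum_mul_conj_eq_zero _ _
    (fun (s : Equiv.Perm (Fin (n + 1))) j => lam (s j.castSucc) - lam (s j.succ))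
    (fun (s : Equiv.Perm (Fin (n + 1))) j => lam' (s j.castSucc) - lam' (s j.succ))
    fun s s' => ⟨fun j => p (s j.castSucc) (s j.succ) - q (s' j.castSucc) (s' j.succ), ?_,
      fun j => by push_cast; rw [hp, hq]⟩
  intro h0
  refine hne ((Fin.strictAnti_iff_succ_lt.mpr hdom).eq_of_comp_perm_eq
    (Fin.strictAnti_iff_succ_lt.mpr hdom') (s := s) (s' := s')
    (eq_of_sub_succ_eq_of_sum_eq (fun j => ?_) ?_))
  · have hj := sub_eq_zero.mp (congrFun h0 j)
    simp only [Function.comp_apply, hp, hq, hj]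
  · simp only [Function.comp_apply, Equiv.sum_comp, hsum, hsum']
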